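/- Let A be a two-player game arena with position set Pos, R ⊆ Pos, and v a position. If Attacker has a winning strategy for the reachability game (A, R) from v, then Attacker has a strategy σ admitting a witness from v of depth at most |Pos| (i.e., a finite prefix of S^σ_v of depth ≤ |Pos| all of whose leaves end in a position of R). -/

import Mathlib

/-! ### Words, merge, synchronized concatenation, s-trees -/

/-- The merge of two sets of words:
`P ⋈ Q = {p ∈ P : ∃ q ∈ Q, q ≼ p} ∪ {q ∈ Q : ∃ p ∈ P, p ≼ q}`. -/
def merge {α : Type*} (P Q : Set (List α)) : Set (List α) :=
  {p | p ∈ P ∧ ∃ q ∈ Q, q <+: p} ∪ {q | q ∈ Q ∧ ∃ p ∈ P, p <+: q}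

/-- Synchronized concatenation, lifted to sets of words: `π ⊙ π'` is defined when the
last letter of `π` equals the first letter of `π'` and concatenates `π` with the tail of `π'`. -/
def sconcat {α : Type*} (P Q : Set (List α)) : Set (List α) :=
  {w | ∃ p ∈ P, ∃ q ∈ Q, p.getLast? = q.head? ∧ w = p ++ q.tail}

/-- An s-tree over an alphabet `α`: a nonempty set of nonempty words, closed under
nonempty prefixes, all words having the same first letter (the root). -/
def IsSTree {α : Type*} (S : Set (List α)) : Prop :=
  S.Nonempty ∧ (∀ w ∈ S, w ≠ []) ∧
  (∀ w ∈ S, ∀ w' : List α, w' <+: w → w' ≠ [] → w' ∈ S) ∧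
  (∃ a, ∀ w ∈ S, w.head? = some a)

/-- A leaf of an s-tree: a word with no proper extension in the tree. -/
def IsLeafOf {α : Type*} (S : Set (List α)) (w : List α) : Prop :=
  w ∈ S ∧ ∀ w' ∈ S, w <+: w' → w' = w

/-- The children of `w` in `S`: its minimal proper extensions in `S`. -/
def childrenOf {α : Type*} (S : Set (List α)) (w : List α) : Set (List α) :=
  {w' | w' ∈ S ∧ w <+: w' ∧ w' ≠ w ∧
    ∀ w'' ∈ S, w <+: w'' → w'' <+: w' → w'' = w ∨ w'' = w'}

/-- `S'` is a prefix of the s-tree `S`: `S'` is an s-tree with the same root,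
`S' ⊆ S`, and every non-leaf of `S'` has the same children in `S'` as in `S`. -/
def TreePrefix {α : Type*} (S' S : Set (List α)) : Prop :=
  IsSTree S' ∧ (∃ a, [a] ∈ S' ∧ [a] ∈ S) ∧ S' ⊆ S ∧
  ∀ w ∈ S', ¬ IsLeafOf S' w → childrenOf S' w = childrenOf S w

/-! ### Transition systems and attack trees -/

/-- A transition system over propositions `π` with states `σ`. -/
structure TSys (σ π : Type*) where
  step : σ → σ → Prop
  val : σ → Set π

/-- A path of a transition system: a nonempty finite sequence of states related by `step`. -/
def IsTPath {σ π : Type*} (T : TSys σ π) (w : List σ) : Prop :=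
  w ≠ [] ∧ List.Chain' T.step w

/-- Attack trees: a leaf is a Boolean formula, identified with the set of states where
it holds; inner nodes are `OR`, `SAND` and `AND` operators. -/
inductive ATree (σ : Type*) where
  | leaf (F : Set σ)
  | or (t₁ t₂ : ATree σ)
  | sand (t₁ t₂ : ATree σ)
  | and (t₁ t₂ : ATree σ)

/-- The number of leaves of an attack tree. -/
def numLeaves {σ : Type*} : ATree σ → ℕ
  | .leaf _ => 1
  | .or t₁ t₂ => numLeaves t₁ + numLeaves t₂
  | .sand t₁ t₂ => numLeaves t₁ + numLeaves t₂
  | .and t₁ t₂ => numLeaves t₁ + numLeaves t₂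

/-- The path semantics of an attack tree over a transition system. -/
def pathSem {σ π : Type*} (T : TSys σ π) : ATree σ → Set (List σ)
  | .leaf F => {w | IsTPath T w ∧ ∃ s ∈ F, w.getLast? = some s}
  | .or t₁ t₂ => pathSem T t₁ ∪ pathSem T t₂
  | .sand t₁ t₂ => sconcat (pathSem T t₁) (pathSem T t₂)
  | .and t₁ t₂ => merge (pathSem T t₁) (pathSem T t₂)

/-! ### Two-player game arenas -/

/-- A two-player concurrent game arena: a total transition function on positions given
joint actions of the two players, and a valuation of positions by atomic propositions. -/
structure Arena (Pos Act₁ Act₂ Prp : Type*) where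
  delta : Pos → Act₁ × Act₂ → Pos
  val : Pos → Set Prp

variable {Pos Act₁ Act₂ Prp : Type*}

/-- A play: an infinite sequence of positions, each next one reached by some joint action. -/
def IsPlay (A : Arena Pos Act₁ Act₂ Prp) (ρ : ℕ → Pos) : Prop :=
  ∀ i : ℕ, ∃ a : Act₁ × Act₂, ρ (i + 1) = A.delta (ρ i) a

/-- The prefix of length `n` of a play. -/
def playPrefix (ρ : ℕ → Pos) (n : ℕ) : List Pos :=
  (List.range n).map ρ

/-- Consistency of a history with a strategy `σ` of the player whose actions are extracted
from joint actions by `proj` (`Prod.fst` for Player 1/Attacker, `Prod.snd` for Player 2). -/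
def ConsistHist {Act : Type*} (A : Arena Pos Act₁ Act₂ Prp) (proj : Act₁ × Act₂ → Act)
    (σ : List Pos → Act) (w : List Pos) : Prop :=
  ∀ (j : ℕ) (h : j + 1 < w.length),
    ∃ a : Act₁ × Act₂,
      A.delta (w[j]'(Nat.lt_of_succ_lt h)) a = w[j + 1]'h ∧ proj a = σ (w.take (j + 1))

/-- A play is consistent with a strategy if all its nonempty finite prefixes are. -/
def ConsistPlay {Act : Type*} (A : Arena Pos Act₁ Act₂ Prp) (proj : Act₁ × Act₂ → Act)
    (σ : List Pos → Act) (ρ : ℕ → Pos) : Prop :=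
  ∀ n : ℕ, ConsistHist A proj σ (playPrefix ρ n)

/-- A history: a nonempty finite prefix of a play. -/
def IsHist (A : Arena Pos Act₁ Act₂ Prp) (w : List Pos) : Prop :=
  ∃ ρ, IsPlay A ρ ∧ ∃ n, 1 ≤ n ∧ w = playPrefix ρ n

/-- `Hist A v`: the histories starting at position `v`. -/
def Hist (A : Arena Pos Act₁ Act₂ Prp) (v : Pos) : Set (List Pos) :=
  {w | ∃ ρ, IsPlay A ρ ∧ ρ 0 = v ∧ ∃ n, 1 ≤ n ∧ w = playPrefix ρ n}

/-- `Prefixes(Out(σ))`: nonempty finite prefixes of plays consistent with `σ`. -/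
def PrefixesOut {Act : Type*} (A : Arena Pos Act₁ Act₂ Prp) (proj : Act₁ × Act₂ → Act)
    (σ : List Pos → Act) : Set (List Pos) :=
  {w | ∃ ρ, IsPlay A ρ ∧ ConsistPlay A proj σ ρ ∧ ∃ n, 1 ≤ n ∧ w = playPrefix ρ n}

/-- The s-tree associated with a strategy `σ` from position `v`:
`S^σ_v = Prefixes(Out(σ)) ∩ Hist(A, v)`. -/
def STree {Act : Type*} (A : Arena Pos Act₁ Act₂ Prp) (proj : Act₁ × Act₂ → Act)
    (σ : List Pos → Act) (v : Pos) : Set (List Pos) :=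
  PrefixesOut A proj σ ∩ Hist A v

/-- The transition system induced by a game arena: `(v, v')` is a transition iff
`δ(v, a) = v'` for some joint action `a`. -/
def arenaTS (A : Arena Pos Act₁ Act₂ Prp) : TSys Pos Prp :=
  ⟨fun v v' => ∃ a : Act₁ × Act₂, A.delta v a = v', A.val⟩

/-- An Attacker strategy is winning for the reachability game `(A, R)` from `v` if every
play consistent with it starting at `v` visits a position of `R`. -/
def WinningFrom (A : Arena Pos Act₁ Act₂ Prp) (σ : List Pos → Act₁) (v : Pos)
    (R : Set Pos) : Prop :=
  ∀ ρ : ℕ → Pos, IsPlay A ρ → ConsistPlay A Prod.fst σ ρ → ρ 0 = v → ∃ i, ρ i ∈ R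

/-- A witness of an Attacker strategy `σ` from `v` for the reachability set `R`:
a finite prefix of `S^σ_v` all of whose leaves end in a position of `R`. -/
def Witness (A : Arena Pos Act₁ Act₂ Prp) (σ : List Pos → Act₁) (v : Pos) (R : Set Pos)
    (S : Set (List Pos)) : Prop :=
  S.Finite ∧ TreePrefix S (STree A Prod.fst σ v) ∧
  ∀ w, IsLeafOf S w → ∃ p ∈ R, w.getLast? = some p

/-- An s-tree over `Pos` is well-formed if it is a prefix of `S^σ_v` for some Attacker
strategy `σ` and position `v`. -/
def WellFormed (A : Arena Pos Act₁ Act₂ Prp) (S : Set (List Pos)) : Prop :=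
  ∃ (σ : List Pos → Act₁) (v : Pos), TreePrefix S (STree A Prod.fst σ v)

/-- The strategy semantics of an attack tree `t` over the arena `A`: the set of all
well-formed `t`-s-trees, i.e. well-formed finite s-trees all of whose leaves belong to
the path semantics of `t` over the transition system induced by `A`. -/
def stratSem (A : Arena Pos Act₁ Act₂ Prp) (t : ATree Pos) : Set (Set (List Pos)) :=
  {S | WellFormed A S ∧ S.Finite ∧ IsSTree S ∧
    ∀ w, IsLeafOf S w → w ∈ pathSem (arenaTS A) t}

/-- The positions from which Attacker can force a visit to `R` within `k` steps. -/
def attractor (A : Arena Pos Act₁ Act₂ Prp) (R : Set Pos) : ℕ → Set Pos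
  | 0 => R
  | k + 1 => attractor A R k ∪ {p | ∃ a, ∀ b, A.delta p (a, b) ∈ attractor A R k}

theorem attractor_mono (A : Arena Pos Act₁ Act₂ Prp) (R : Set Pos) :
    Monotone (attractor A R) :=
  monotone_nat_of_le_succ fun _ => Set.subset_union_left

/-- The attractor sequence is stationary from index `|Pos| - 1` on. -/
theorem attractor_stable [Fintype Pos] (A : Arena Pos Act₁ Act₂ Prp) {R : Set Pos}
    (hR : R.Nonempty) :
    attractor A R (Fintype.card Pos - 1 + 1) = attractor A R (Fintype.card Pos - 1) := by
  have key : ∀ k, k + 1 ≤ (attractor A R k).ncard ∨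
      attractor A R (k + 1) = attractor A R k := by
    intro k
    induction k with
    | zero => exact Or.inl (Set.ncard_pos (Set.toFinite _) |>.2 hR)
    | succ k ih =>
      by_cases h : attractor A R (k + 1) = attractor A R k
      · right
        rw [attractor, h, ← attractor, h]
      · left
        have hlt : attractor A R k ⊂ attractor A R (k + 1) :=
          (attractor_mono A R k.le_succ).ssubset_of_ne (Ne.symm h)
        have := Set.ncard_lt_ncard hlt (Set.toFinite _)
        have := ih.resolve_right h
        omega
  rcases key (Fintype.card Pos - 1) with h | h
  · have huniv : attractor A R (Fintype.card Pos - 1) = Set.univ := by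
      refine Set.eq_of_subset_of_ncard_le (Set.subset_univ _) ?_ (Set.toFinite _)
      rw [Set.ncard_univ, Nat.card_eq_fintype_card]
      omega
    rw [attractor, huniv, Set.univ_union]
  · exact h

/-- A positional choice of Attacker actions that decreases the attractor index. -/
theorem exists_attractor_action [Nonempty Act₁] (A : Arena Pos Act₁ Act₂ Prp) (R : Set Pos) :
    ∃ act : Pos → Act₁, ∀ p ∉ R, ∀ k, p ∈ attractor A R (k + 1) →
      ∀ b, A.delta p (act p, b) ∈ attractor A R k := by
  classical
  have : ∀ p, ∃ a : Act₁, p ∉ R → ∀ k, p ∈ attractor A R (k + 1) →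
      ∀ b, A.delta p (a, b) ∈ attractor A R k := by
    intro p
    by_cases hp : p ∉ R ∧ ∃ k, p ∈ attractor A R k
    · obtain ⟨hpR, hk⟩ := hp
      obtain ⟨m, hm⟩ : ∃ m, Nat.find hk = m + 1 := by
        refine Nat.exists_eq_succ_of_ne_zero fun h0 => hpR ?_
        have := Nat.find_spec hk
        rwa [h0] at this
      have hmem := Nat.find_spec hk
      rw [hm] at hmem
      obtain ⟨a, ha⟩ := hmem.resolve_left (Nat.find_min hk (by omega))
      refine ⟨a, fun _ k hpk b => attractor_mono A R ?_ (ha b)⟩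
      have := Nat.find_min' hk hpk
      omega
    · exact ⟨Classical.arbitrary _, fun h k hk => (hp ⟨h, _, hk⟩).elim⟩
  choose act hact using this
  exact ⟨act, hact⟩

theorem playPrefix_succ (ρ : ℕ → Pos) (n : ℕ) :
    playPrefix ρ (n + 1) = playPrefix ρ n ++ [ρ n] := by
  simp [playPrefix, List.range_succ]

theorem length_playPrefix (ρ : ℕ → Pos) (n : ℕ) : (playPrefix ρ n).length = n := by
  simp [playPrefix]

theorem take_playPrefix (ρ : ℕ → Pos) (m n : ℕ) :
    (playPrefix ρ n).take m = playPrefix ρ (min m n) := by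
  simp [playPrefix, ← List.map_take, List.take_range]

theorem getLast?_playPrefix_succ (ρ : ℕ → Pos) (n : ℕ) :
    (playPrefix ρ (n + 1)).getLast? = some (ρ n) := by
  simp [playPrefix_succ]

theorem head?_playPrefix (ρ : ℕ → Pos) {n : ℕ} (hn : 1 ≤ n) :
    (playPrefix ρ n).head? = some (ρ 0) := by
  obtain ⟨m, rfl⟩ := Nat.exists_eq_add_of_le' hn
  simp [playPrefix, List.range_succ_eq_map]

theorem consistPlay_iff {Act : Type*} (A : Arena Pos Act₁ Act₂ Prp)
    (proj : Act₁ × Act₂ → Act) (σ : List Pos → Act) (ρ : ℕ → Pos) :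
    ConsistPlay A proj σ ρ ↔
      ∀ i, ∃ a, A.delta (ρ i) a = ρ (i + 1) ∧ proj a = σ (playPrefix ρ (i + 1)) := by
  constructor
  · intro h i
    have := h (i + 2) i (by rw [length_playPrefix]; omega)
    rw [take_playPrefix, min_eq_left (by omega)] at this
    simpa [playPrefix] using this
  · intro h n j hj
    have hj' := hj
    rw [length_playPrefix] at hj'
    rw [take_playPrefix, min_eq_left (by omega)]
    simpa [playPrefix] using h j

/-- Any positional response of Defender yields a play consistent with a given Attacker
strategy. -/
theorem exists_play_of_response (A : Arena Pos Act₁ Act₂ Prp) (σ : List Pos → Act₁)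
    (resp : Pos → Act₁ → Act₂) (v : Pos) :
    ∃ ρ : ℕ → Pos, ρ 0 = v ∧ IsPlay A ρ ∧ ConsistPlay A Prod.fst σ ρ ∧
      ∀ i, ∃ a, ρ (i + 1) = A.delta (ρ i) (a, resp (ρ i) a) := by
  let nxt : List Pos × Pos → List Pos × Pos := fun s =>
    (s.1 ++ [s.2],
      A.delta s.2 (σ (s.1 ++ [s.2]), resp s.2 (σ (s.1 ++ [s.2]))))
  let st : ℕ → List Pos × Pos := fun n => nxt^[n] ([], v)
  have hst : ∀ n, st (n + 1) = nxt (st n) := fun n => Function.iterate_succ_apply' _ _ _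
  have hpre : ∀ n, (st n).1 = playPrefix (fun i => (st i).2) n := by
    intro n
    induction n with
    | zero => rfl
    | succ n ih => rw [playPrefix_succ, ← ih, hst]
  have hstep : ∀ i, (st (i + 1)).2 = A.delta (st i).2
      (σ (playPrefix (fun i => (st i).2) (i + 1)),
        resp (st i).2 (σ (playPrefix (fun i => (st i).2) (i + 1)))) := by
    intro i
    rw [hst, playPrefix_succ, ← hpre]
  exact ⟨fun i => (st i).2, rfl, fun i => ⟨_, hstep i⟩,
    (consistPlay_iff ..).2 fun i => ⟨_, (hstep i).symm, rfl⟩, fun i => ⟨_, hstep i⟩⟩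

/-- A position from which Attacker wins belongs to some attractor. -/
theorem mem_attractor_of_winningFrom [Fintype Pos] [Nonempty Act₂]
    {A : Arena Pos Act₁ Act₂ Prp} {R : Set Pos} {v : Pos} {σ : List Pos → Act₁}
    (h : WinningFrom A σ v R) : v ∈ attractor A R (Fintype.card Pos - 1) := by
  classical
  have hR : R.Nonempty := by
    obtain ⟨ρ, h0, hplay, hcons, -⟩ :=
      exists_play_of_response A σ (fun _ _ => Classical.arbitrary _) v
    obtain ⟨i, hi⟩ := h ρ hplay hcons h0
    exact ⟨_, hi⟩
  by_contra hv
  have hresp : ∀ p a, ∃ b, p ∉ attractor A R (Fintype.card Pos - 1) →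
      A.delta p (a, b) ∉ attractor A R (Fintype.card Pos - 1) := by
    intro p a
    by_contra! hc
    refine (hc (Classical.arbitrary _)).1 ?_
    rw [← attractor_stable A hR]
    exact Or.inr ⟨a, fun b => (hc b).2⟩
  choose resp hresp using hresp
  obtain ⟨ρ, h0, hplay, hcons, hρ⟩ := exists_play_of_response A σ resp v
  have hout : ∀ i, ρ i ∉ attractor A R (Fintype.card Pos - 1) := by
    intro i
    induction i with
    | zero => rwa [h0]
    | succ i ih =>
      obtain ⟨a, ha⟩ := hρ i
      rw [ha]
      exact hresp _ _ ih
  obtain ⟨i, hi⟩ := h ρ hplay hcons h0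
  exact hout i (attractor_mono A R (Nat.zero_le _) hi)

theorem mem_sTree_iff {Act : Type*} {A : Arena Pos Act₁ Act₂ Prp}
    {proj : Act₁ × Act₂ → Act} {σ : List Pos → Act} {v : Pos} {w : List Pos} :
    w ∈ STree A proj σ v ↔ ∃ ρ, IsPlay A ρ ∧ ConsistPlay A proj σ ρ ∧ ρ 0 = v ∧
      ∃ n, 1 ≤ n ∧ w = playPrefix ρ n := by
  constructor
  · rintro ⟨⟨ρ, hplay, hcons, n, hn, rfl⟩, ρ', -, h0, m, hm, heq⟩
    refine ⟨ρ, hplay, hcons, ?_, n, hn, rfl⟩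
    have := congrArg List.head? heq
    rw [head?_playPrefix _ hn, head?_playPrefix _ hm, h0] at this
    exact Option.some.inj this
  · rintro ⟨ρ, hplay, hcons, h0, n, hn, rfl⟩
    exact ⟨⟨ρ, hplay, hcons, n, hn, rfl⟩, ρ, hplay, h0, n, hn, rfl⟩

theorem sTree_prefix_closed {Act : Type*} {A : Arena Pos Act₁ Act₂ Prp}
    {proj : Act₁ × Act₂ → Act} {σ : List Pos → Act} {v : Pos} {w w' : List Pos}
    (hw : w ∈ STree A proj σ v) (hpre : w' <+: w) (hne : w' ≠ []) :
    w' ∈ STree A proj σ v := by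
  obtain ⟨ρ, hplay, hcons, h0, n, hn, rfl⟩ := mem_sTree_iff.1 hw
  refine mem_sTree_iff.2 ⟨ρ, hplay, hcons, h0, min w'.length n,
    le_min (List.length_pos_iff.2 hne) hn, ?_⟩
  rw [← take_playPrefix]
  exact List.prefix_iff_eq_take.1 hpre

/-- The words of `T` that do not visit `R` strictly before their last letter. -/
def pruneAt {α : Type*} (T : Set (List α)) (R : Set α) : Set (List α) :=
  {w | w ∈ T ∧ ∀ u, u <+: w → u ≠ w → ∀ p ∈ R, u.getLast? ≠ some p}

theorem pruneAt_prefix_closed {α : Type*} {T : Set (List α)} {R : Set α} {w w' : List α}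
    (hw : w ∈ pruneAt T R) (hpre : w' <+: w) (hT : w' ∈ T) : w' ∈ pruneAt T R := by
  refine ⟨hT, fun u hu hne => hw.2 u (hu.trans hpre) ?_⟩
  rintro rfl
  exact hne (hu.eq_of_length_le hpre.length_le)

/-- Pruning an s-tree at the first visits to `R` yields a prefix of it. -/
theorem treePrefix_pruneAt {α : Type*} {T : Set (List α)} (hT : IsSTree T) (R : Set α) :
    TreePrefix (pruneAt T R) T := by
  obtain ⟨⟨w₀, hw₀⟩, hne, hclosed, a, ha⟩ := hT
  have hroot : [a] ∈ T := by
    refine hclosed w₀ hw₀ [a] ?_ (by simp)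
    have := ha w₀ hw₀
    cases w₀ with
    | nil => simp at this
    | cons b l => simpa [eq_comm] using this
  have hroot' : [a] ∈ pruneAt T R := by
    refine ⟨hroot, fun u hu hua p _ => ?_⟩
    rcases List.prefix_cons_iff.1 hu with rfl | ⟨t, rfl, ht⟩
    · simp
    · exact (hua (by simp [List.prefix_nil.1 ht])).elim
  refine ⟨⟨⟨_, hroot'⟩, fun w hw => hne w hw.1,
    fun w hw w' hpre h => pruneAt_prefix_closed hw hpre (hclosed w hw.1 w' hpre h),
    a, fun w hw => ha w hw.1⟩, ⟨a, hroot', hroot⟩, fun w hw => hw.1, ?_⟩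
  intro w hw hleaf
  have hlast : ∀ p ∈ R, w.getLast? ≠ some p := by
    intro p hp hwp
    refine hleaf ⟨hw, fun w' hw' hpre => ?_⟩
    by_contra hww'
    exact hw'.2 w hpre (Ne.symm hww') p hp hwp
  ext w'
  constructor
  · rintro ⟨hw', hpre, hne', hmin⟩
    exact ⟨hw'.1, hpre, hne', fun u hu hwu huw' =>
      hmin u (pruneAt_prefix_closed hw' huw' hu) hwu huw'⟩
  · rintro ⟨hw', hpre, hne', hmin⟩
    refine ⟨⟨hw', fun u hu huw' p hp hup => ?_⟩, hpre, hne', fun u hu => hmin u hu.1⟩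
    rcases List.prefix_or_prefix_of_prefix hu hpre with h | h
    · by_cases huw : u = w
      · exact hlast p hp (huw ▸ hup)
      · exact hw.2 u h huw p hp hup
    · have huT : u ∈ T := hclosed w' hw' u hu (by rintro rfl; simp at hup)
      rcases hmin u huT h hu with rfl | rfl
      · exact hlast p hp hup
      · exact huw' rfl

theorem isSTree_sTree [Nonempty Act₂] (A : Arena Pos Act₁ Act₂ Prp) (σ : List Pos → Act₁)
    (v : Pos) : IsSTree (STree A Prod.fst σ v) := by
  refine ⟨?_, ?_, fun w hw w' hpre hne => sTree_prefix_closed hw hpre hne, v, ?_⟩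
  · obtain ⟨ρ, h0, hplay, hcons, -⟩ :=
      exists_play_of_response A σ (fun _ _ => Classical.arbitrary _) v
    exact ⟨_, mem_sTree_iff.2 ⟨ρ, hplay, hcons, h0, 1, le_rfl, rfl⟩⟩
  · intro w hw
    obtain ⟨ρ, -, -, -, n, hn, rfl⟩ := mem_sTree_iff.1 hw
    rw [← List.length_pos_iff, length_playPrefix]
    omega
  · intro w hw
    obtain ⟨ρ, -, -, h0, n, hn, rfl⟩ := mem_sTree_iff.1 hw
    rw [head?_playPrefix ρ hn, h0]

/-- The leaves of the strategy tree pruned at `R` end in `R`. -/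
theorem leaf_pruneAt_sTree {A : Arena Pos Act₁ Act₂ Prp} {σ : List Pos → Act₁} {v : Pos}
    {R : Set Pos} {w : List Pos} (hw : IsLeafOf (pruneAt (STree A Prod.fst σ v) R) w) :
    ∃ p ∈ R, w.getLast? = some p := by
  obtain ⟨hmem, hmax⟩ := hw
  obtain ⟨ρ, hplay, hcons, h0, n, hn, rfl⟩ := mem_sTree_iff.1 hmem.1
  by_contra! hc
  have hsucc : playPrefix ρ (n + 1) ∈ pruneAt (STree A Prod.fst σ v) R := by
    refine ⟨mem_sTree_iff.2 ⟨ρ, hplay, hcons, h0, n + 1, by omega, rfl⟩, ?_⟩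
    intro u hu hne p hp
    rw [playPrefix_succ] at hu hne
    have hu' := (List.prefix_concat_iff.1 hu).resolve_left hne
    by_cases huw : u = playPrefix ρ n
    · rw [huw]
      exact hc p hp
    · exact hmem.2 u hu' huw p hp
  have := congrArg List.length
    (hmax _ hsucc (by rw [playPrefix_succ]; exact List.prefix_append _ _))
  simp [length_playPrefix] at this

/-- Under a strategy decreasing the attractor index, the strategy tree pruned at `R` has depth
at most one more than the index of its root. -/
theorem length_le_of_mem_pruneAt {A : Arena Pos Act₁ Act₂ Prp} {R : Set Pos} {v : Pos}
    {act : Pos → Act₁}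
    (hact : ∀ p ∉ R, ∀ k, p ∈ attractor A R (k + 1) →
      ∀ b, A.delta p (act p, b) ∈ attractor A R k)
    {σ : List Pos → Act₁} (hσ : ∀ w p, w.getLast? = some p → σ w = act p)
    {N : ℕ} (hv : v ∈ attractor A R N) {w : List Pos}
    (hw : w ∈ pruneAt (STree A Prod.fst σ v) R) : w.length ≤ N + 1 := by
  obtain ⟨ρ, hplay, hcons, h0, n, hn, rfl⟩ := mem_sTree_iff.1 hw.1
  rw [length_playPrefix]
  have hnotR : ∀ i, i + 1 < n → ρ i ∉ R := by
    intro i hi hR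
    refine hw.2 (playPrefix ρ (i + 1)) ?_ (fun h => ?_) _ hR (getLast?_playPrefix_succ ρ i)
    · rw [← min_eq_left hi.le, ← take_playPrefix]
      exact List.take_prefix _ _
    · have := congrArg List.length h
      simp only [length_playPrefix] at this
      omega
  by_contra! hlt
  have hmem : ∀ i k, i + k = N → ρ i ∈ attractor A R k := by
    intro i
    induction i with
    | zero =>
      rintro k hk
      rw [h0, show k = N by omega]
      exact hv
    | succ i ih =>
      intro k hk
      obtain ⟨⟨a, b⟩, hstep, ha⟩ := (consistPlay_iff ..).1 hcons i
      rw [hσ _ _ (getLast?_playPrefix_succ ρ i)] at ha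
      rw [← hstep, show a = act (ρ i) from ha]
      exact hact _ (hnotR i (by omega)) k (ih (k + 1) (by omega)) b
  exact hnotR N hlt (hmem N 0 rfl)

theorem witness_of_bounded_depth {Pos Act₁ Act₂ Prp : Type*}
    [Fintype Pos] [Nonempty Pos] [Finite Act₁] [Nonempty Act₁] [Finite Act₂] [Nonempty Act₂]
    (A : Arena Pos Act₁ Act₂ Prp) (R : Set Pos) (v : Pos)
    (h : ∃ σ : List Pos → Act₁, WinningFrom A σ v R) :
    ∃ (σ : List Pos → Act₁) (S : Set (List Pos)),
      Witness A σ v R S ∧ ∀ w ∈ S, w.length ≤ Fintype.card Pos := by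
  obtain ⟨τ, hτ⟩ := h
  have hv := mem_attractor_of_winningFrom hτ
  obtain ⟨act, hact⟩ := exists_attractor_action A R
  let σ : List Pos → Act₁ := fun w => act (w.getLast?.getD v)
  have hσ : ∀ w p, w.getLast? = some p → σ w = act p := fun w p hwp => by simp [σ, hwp]
  have hlen : ∀ w ∈ pruneAt (STree A Prod.fst σ v) R, w.length ≤ Fintype.card Pos := by
    intro w hw
    have := length_le_of_mem_pruneAt hact hσ hv hw
    have := Fintype.card_pos (α := Pos)
    omega
  exact ⟨σ, pruneAt (STree A Prod.fst σ v) R,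
    ⟨(List.finite_length_le Pos (Fintype.card Pos)).subset hlen,
      treePrefix_pruneAt (isSTree_sTree A σ v) R, fun w hw => leaf_pruneAt_sTree hw⟩, hlen⟩
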